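/- The AG-generating map α_AG from DAGs to ancestral graphs is surjective: for every ancestral graph H there exist a directed acyclic graph G and disjoint subsets M and C of the node set of G such that α_AG(G;M,C) = H. -/

import Mathlib

/-!
Stable mixed graphs: mixed graphs with arrows, arcs and lines; ribbonless,
summary and ancestral graphs; the generating maps α_RG, α_SG, α_AG;
m-connecting paths, m-separation and induced independence models.
-/

namespace StableMixedGraphs

/-- A mixed graph on node type `V`: a node set together with three edge
relations: arrows (`arrow i j` means an arrow from `i` to `j`), arcs
(two-headed, symmetric) and lines (undirected, symmetric). -/
structure MixedGraph (V : Type) where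
  nodes : Set V
  arrow : V → V → Prop
  arc : V → V → Prop
  line : V → V → Prop

namespace MixedGraph

variable {V W : Type}

/-- Wellformedness: arcs and lines are symmetric relations and all edges join
nodes of the graph. -/
def Wf (G : MixedGraph V) : Prop :=
  (∀ i j, G.arc i j → G.arc j i) ∧
  (∀ i j, G.line i j → G.line j i) ∧
  (∀ i j, G.arrow i j ∨ G.arc i j ∨ G.line i j → i ∈ G.nodes ∧ j ∈ G.nodes)

/-- No loops of any of the three kinds. -/
def Loopless (G : MixedGraph V) : Prop :=
  ∀ i, ¬ G.arrow i i ∧ ¬ G.arc i i ∧ ¬ G.line i i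

/-- A loopless mixed graph with a finite node set. -/
def IsLMG (G : MixedGraph V) : Prop := G.Wf ∧ G.Loopless ∧ G.nodes.Finite

/-- `G.anc i j` : `i` is an ancestor of `j`, i.e. there is a
direction-preserving path from `i` to `j`. -/
def anc (G : MixedGraph V) (i j : V) : Prop := Relation.TransGen G.arrow i j

/-- The set of ancestors of nodes of `C`. -/
def anSet (G : MixedGraph V) (C : Set V) : Set V := {a | ∃ c ∈ C, G.anc a c}

/-- `i` lies on a direction-preserving cycle. -/
def OnDPCycle (G : MixedGraph V) (i : V) : Prop := G.anc i i

/-- `i` is an endpoint of a line. -/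
def LineEndpoint (G : MixedGraph V) (i : V) : Prop := ∃ j, G.line i j

/-- Condition (2) of a ribbon: `i` or a descendant of `i` is an endpoint of a
line or lies on a direction-preserving cycle. -/
def RibbonTail (G : MixedGraph V) (i : V) : Prop :=
  ∃ d, (d = i ∨ G.anc i d) ∧ (G.LineEndpoint d ∨ G.OnDPCycle d)

/-- `G` contains a ribbon: a collider V-configuration `⟨h,i,j⟩` with no
endpoint-identical edge between `h` and `j`, whose inner node `i` (or a
descendant of it) is an endpoint of a line or on a direction-preserving
cycle. -/
def HasRibbon (G : MixedGraph V) : Prop :=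
  ∃ h i j, h ≠ i ∧ i ≠ j ∧ h ≠ j ∧ G.RibbonTail i ∧
    ((G.arc h i ∧ G.arc i j ∧ ¬ G.arc h j) ∨
     (G.arrow h i ∧ G.arrow j i ∧ ¬ G.line h j) ∨
     (G.arrow h i ∧ G.arc i j ∧ ¬ G.arrow h j))

/-- A ribbonless graph: a loopless mixed graph with no ribbon. -/
def IsRG (G : MixedGraph V) : Prop := G.IsLMG ∧ ¬ G.HasRibbon

/-- A directed acyclic graph: only arrows, no direction-preserving cycle. -/
def IsDAG (G : MixedGraph V) : Prop :=
  G.IsLMG ∧ (∀ i j, ¬ G.arc i j) ∧ (∀ i j, ¬ G.line i j) ∧ ∀ i, ¬ G.anc i i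

/-- A summary graph: a loopless mixed graph with no arrowhead pointing to an
endpoint of a line and no direction-preserving cycle. -/
def IsSG (G : MixedGraph V) : Prop :=
  G.IsLMG ∧ (∀ i, G.LineEndpoint i → ∀ k, ¬ G.arrow k i ∧ ¬ G.arc k i) ∧
    ∀ i, ¬ G.anc i i

/-- A simple mixed graph: no loops and no multiple edges. -/
def Simple (G : MixedGraph V) : Prop :=
  G.Loopless ∧ ∀ i j,
    (G.arrow i j → ¬ G.arrow j i ∧ ¬ G.arc i j ∧ ¬ G.line i j) ∧
    (G.arc i j → ¬ G.line i j)

/-- An ancestral graph: a simple mixed graph such that no node is an ancestor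
of one of its parents or spouses, and a node with a neighbour has neither
parents nor spouses. -/
def IsAG (G : MixedGraph V) : Prop :=
  G.Wf ∧ G.Simple ∧ G.nodes.Finite ∧
  (∀ i j, G.arrow j i ∨ G.arc j i → ¬ G.anc i j) ∧
  (∀ i, G.LineEndpoint i → ∀ k, ¬ G.arrow k i ∧ ¬ G.arc k i)

/-- An undirected graph: only lines. -/
def IsUG (G : MixedGraph V) : Prop :=
  G.IsLMG ∧ (∀ i j, ¬ G.arrow i j) ∧ ∀ i j, ¬ G.arc i j

/-- A bidirected graph: only arcs. -/
def IsBG (G : MixedGraph V) : Prop :=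
  G.IsLMG ∧ (∀ i j, ¬ G.arrow i j) ∧ ∀ i j, ¬ G.line i j

/-- Image of a mixed graph under a map of node types. -/
def map (f : V → W) (G : MixedGraph V) : MixedGraph W where
  nodes := f '' G.nodes
  arrow a b := ∃ i j, G.arrow i j ∧ f i = a ∧ f j = b
  arc a b := ∃ i j, G.arc i j ∧ f i = a ∧ f j = b
  line a b := ∃ i j, G.line i j ∧ f i = a ∧ f j = b

end MixedGraph

/-! ### The closure generating new edges (Table 1 of the RG-generating
algorithm), for given marginalisation set `M` and collider set
`S = C ∪ an(C)`.  For every V-configuration whose inner node is a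
non-collider in `M` (rows 1–7) or a collider in `S` (rows 8–10) the
endpoint-identical edge between the endpoints is generated, repeatedly
until closure. -/

mutual
  /-- Generated arrows (`GenArrow H M S j i`: arrow from `j` to `i`). -/
  inductive GenArrow {V : Type} (H : MixedGraph V) (M S : Set V) : V → V → Prop
    | base {i j : V} : H.arrow i j → GenArrow H M S i j
    | row1 {i j m : V} : m ∈ M → j ≠ i →
        GenArrow H M S j m → GenArrow H M S m i → GenArrow H M S j i
    | row2 {i j m : V} : m ∈ M → j ≠ i →
        GenLine H M S j m → GenArrow H M S m i → GenArrow H M S j i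
    | row3 {i j m : V} : m ∈ M → j ≠ i →
        GenLine H M S j m → GenArc H M S m i → GenArrow H M S j i
    | row8 {i j s : V} : s ∈ S → j ≠ i →
        GenArrow H M S j s → GenArc H M S s i → GenArrow H M S j i

  /-- Generated arcs. -/
  inductive GenArc {V : Type} (H : MixedGraph V) (M S : Set V) : V → V → Prop
    | base {i j : V} : H.arc i j → GenArc H M S i j
    | symm {i j : V} : GenArc H M S i j → GenArc H M S j i
    | row4 {i j m : V} : m ∈ M → i ≠ j →
        GenArrow H M S m i → GenArrow H M S m j → GenArc H M S i j
    | row5 {i j m : V} : m ∈ M → i ≠ j →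
        GenArrow H M S m i → GenArc H M S m j → GenArc H M S i j
    | row9 {i j s : V} : s ∈ S → i ≠ j →
        GenArc H M S i s → GenArc H M S s j → GenArc H M S i j

  /-- Generated lines. -/
  inductive GenLine {V : Type} (H : MixedGraph V) (M S : Set V) : V → V → Prop
    | base {i j : V} : H.line i j → GenLine H M S i j
    | symm {i j : V} : GenLine H M S i j → GenLine H M S j i
    | row6 {i j m : V} : m ∈ M → i ≠ j →
        GenLine H M S i m → GenArrow H M S j m → GenLine H M S i j
    | row7 {i j m : V} : m ∈ M → i ≠ j →
        GenLine H M S i m → GenLine H M S m j → GenLine H M S i j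
    | row10 {i j s : V} : s ∈ S → i ≠ j →
        GenArrow H M S i s → GenArrow H M S j s → GenLine H M S i j
end

variable {V : Type}

/-- The RG-generating map `α_RG(H;M,C)`: generate all edges of the closure
and delete the nodes of `M ∪ C`. -/
def alphaRG (H : MixedGraph V) (M C : Set V) : MixedGraph V where
  nodes := H.nodes \ (M ∪ C)
  arrow i j := i ∈ H.nodes \ (M ∪ C) ∧ j ∈ H.nodes \ (M ∪ C) ∧
    GenArrow H M (C ∪ H.anSet C) i j
  arc i j := i ∈ H.nodes \ (M ∪ C) ∧ j ∈ H.nodes \ (M ∪ C) ∧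
    GenArc H M (C ∪ H.anSet C) i j
  line i j := i ∈ H.nodes \ (M ∪ C) ∧ j ∈ H.nodes \ (M ∪ C) ∧
    GenLine H M (C ∪ H.anSet C) i j

/-- The arrowhead-removal operation `α_RG.SG(K;A)`: every arrowhead pointing
at a node of `A` is removed (an arrow at such a node becomes a line, an arc
becomes an arrow, an arc with both endpoints in `A` becomes a line),
repeatedly until closure. -/
def deheadAt (K : MixedGraph V) (A : Set V) : MixedGraph V where
  nodes := K.nodes
  arrow j i := i ∉ A ∧ (K.arrow j i ∨ (K.arc j i ∧ j ∈ A))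
  arc i j := K.arc i j ∧ i ∉ A ∧ j ∉ A
  line i j := K.line i j ∨ (K.arrow j i ∧ i ∈ A) ∨ (K.arrow i j ∧ j ∈ A) ∨
    (K.arc i j ∧ i ∈ A ∧ j ∈ A)

/-- The SG-generating map `α_SG(H;M,C)`: mark the nodes of `an(C)`, apply the
RG-generating construction, then remove all arrowheads pointing at marked
nodes. -/
def alphaSG (H : MixedGraph V) (M C : Set V) : MixedGraph V :=
  deheadAt (alphaRG H M C) (H.anSet C)

/-! ### Step 2 of the AG-generating algorithm: for every V-configuration
`j → k ↔ i` or `j ↔ k ↔ i` with `k ∈ an(i)` (in the current graph) generate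
an arrow from `j` to `i`, respectively an arc between `j` and `i`, until
closure. -/

mutual
  inductive AG2Arrow {V : Type} (K : MixedGraph V) : V → V → Prop
    | base {i j : V} : K.arrow j i → AG2Arrow K j i
    | gen {i j k : V} : j ≠ i → AG2Arrow K j k → AG2Arc K k i →
        AG2Anc K k i → AG2Arrow K j i

  inductive AG2Arc {V : Type} (K : MixedGraph V) : V → V → Prop
    | base {i j : V} : K.arc i j → AG2Arc K i j
    | symm {i j : V} : AG2Arc K i j → AG2Arc K j i
    | gen {i j k : V} : j ≠ i → AG2Arc K j k → AG2Arc K k i →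
        AG2Anc K k i → AG2Arc K j i

  /-- The ancestor relation of the graph being generated in step 2. -/
  inductive AG2Anc {V : Type} (K : MixedGraph V) : V → V → Prop
    | single {i j : V} : AG2Arrow K i j → AG2Anc K i j
    | tail {i k j : V} : AG2Arrow K i k → AG2Anc K k j → AG2Anc K i j
end

/-- The graph after step 2 of the AG-generating algorithm. -/
def ag2 (K : MixedGraph V) : MixedGraph V where
  nodes := K.nodes
  arrow := AG2Arrow K
  arc := AG2Arc K
  line := K.line

/-! ### Step 3 of the AG-generating algorithm: repeatedly replace every arc
between `j` and `i` with `j ∈ an(i)` (in the current graph) by an arrow from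
`j` to `i`. -/

mutual
  inductive AG3Arrow {V : Type} (K : MixedGraph V) : V → V → Prop
    | base {i j : V} : K.arrow j i → AG3Arrow K j i
    | conv {i j : V} : K.arc j i → AG3Anc K j i → AG3Arrow K j i

  /-- The ancestor relation of the graph being generated in step 3. -/
  inductive AG3Anc {V : Type} (K : MixedGraph V) : V → V → Prop
    | single {i j : V} : AG3Arrow K i j → AG3Anc K i j
    | tail {i k j : V} : AG3Arrow K i k → AG3Anc K k j → AG3Anc K i j
end

/-- Steps 2 and 3 of the AG-generating algorithm, applied to a summary
graph: `α_SG.AG`. -/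
def alphaSGAG (K : MixedGraph V) : MixedGraph V :=
  let K2 := ag2 K
  { nodes := K.nodes
    arrow := AG3Arrow K2
    arc := fun i j => K2.arc i j ∧ ¬ AG3Anc K2 i j ∧ ¬ AG3Anc K2 j i
    line := K.line }

/-- The AG-generating map `α_AG(H;M,C)`. -/
def alphaAG (H : MixedGraph V) (M C : Set V) : MixedGraph V :=
  alphaSGAG (alphaSG H M C)

/-! ### Paths, m-connection and m-separation. -/

/-- A step of a walk: it goes from `src` to `tgt` along an edge which has an
arrowhead at `src` iff `hs = true` and an arrowhead at `tgt` iff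
`ht = true` (so `hs = ht = false` is a line, `hs = ht = true` an arc, and
exactly one head an arrow in the corresponding direction). -/
structure Step (V : Type) where
  src : V
  tgt : V
  hs : Bool
  ht : Bool

/-- The edge of a step is present in `G`. -/
def Step.valid (G : MixedGraph V) (s : Step V) : Prop :=
  match s.hs, s.ht with
  | false, false => G.line s.src s.tgt
  | false, true  => G.arrow s.src s.tgt
  | true,  false => G.arrow s.tgt s.src
  | true,  true  => G.arc s.src s.tgt

/-- `w` is a path from `i` to `j` in `G`: a nonempty chained list of valid
steps with no repeated nodes. -/
def IsPath (G : MixedGraph V) (i j : V) (w : List (Step V)) : Prop :=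
  w ≠ [] ∧ (∀ s ∈ w, s.valid G) ∧ List.Chain' (fun a b => a.tgt = b.src) w ∧
    w.head?.map Step.src = some i ∧ w.getLast?.map Step.tgt = some j ∧
    (i :: w.map Step.tgt).Nodup

/-- The path `w` is m-connecting given `M` and `C`: every inner collider node
is in `C ∪ an(C)` and every inner non-collider node is in `M`. -/
def MConnPath (G : MixedGraph V) (M C : Set V) (w : List (Step V)) : Prop :=
  List.Chain'
    (fun a b =>
      (a.ht = true ∧ b.hs = true → a.tgt ∈ C ∪ G.anSet C) ∧
      (¬ (a.ht = true ∧ b.hs = true) → a.tgt ∈ M)) w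

/-- `A ⊥_m B | C` in `G` : there is no m-connecting path between `A` and `B`
given `C` (with `M` the remaining nodes). -/
def MSep (G : MixedGraph V) (A B C : Set V) : Prop :=
  ∀ i ∈ A, ∀ j ∈ B, ∀ w : List (Step V),
    IsPath G i j w → ¬ MConnPath G (G.nodes \ (A ∪ B ∪ C)) C w

/-- The independence model induced by `G` via m-separation: the set of
triples `⟨A,B|C⟩` of pairwise disjoint subsets of the nodes with
`A ⊥_m B | C`. -/
def Jm (G : MixedGraph V) : Set (Set V × Set V × Set V) :=
  {t | t.1 ⊆ G.nodes ∧ t.2.1 ⊆ G.nodes ∧ t.2.2 ⊆ G.nodes ∧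
    Disjoint t.1 t.2.1 ∧ Disjoint t.1 t.2.2 ∧ Disjoint t.2.1 t.2.2 ∧
    MSep G t.1 t.2.1 t.2.2}

/-- The independence model after marginalisation over `M` and conditioning on
`C` : `α(J;M,C)`. -/
def alphaIM (J : Set (Set V × Set V × Set V)) (M C : Set V) :
    Set (Set V × Set V × Set V) :=
  {t | (t.1, t.2.1, t.2.2 ∪ C) ∈ J ∧ (t.1 ∪ t.2.1 ∪ t.2.2) ∩ (M ∪ C) = ∅}

theorem MixedGraph.eq_of_iff {W : Type} {K L : MixedGraph W} (hn : K.nodes = L.nodes)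
    (ha : ∀ x y, K.arrow x y ↔ L.arrow x y) (hb : ∀ x y, K.arc x y ↔ L.arc x y)
    (hl : ∀ x y, K.line x y ↔ L.line x y) : K = L := by
  cases K
  cases L
  simp only [MixedGraph.mk.injEq]
  exact ⟨hn, funext₂ fun x y => propext (ha x y), funext₂ fun x y => propext (hb x y),
    funext₂ fun x y => propext (hl x y)⟩

/-! ### Steps 2 and 3 fix graphs in which no arc joins a node to an ancestor -/

section AncestralSteps

variable {W : Type} {K : MixedGraph W}

mutual
  theorem AG2Arrow.arrow_of_no_anc_arc (hs : ∀ x y, K.arc x y → K.arc y x)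
      (h : ∀ x y, K.arc x y → ¬ K.anc x y) :
      ∀ {x y : W}, AG2Arrow K x y → K.arrow x y
    | _, _, .base e => e
    | _, _, .gen _ _ e a =>
      (h _ _ (e.arc_of_no_anc_arc hs h) (a.anc_of_no_anc_arc hs h)).elim

  theorem AG2Arc.arc_of_no_anc_arc (hs : ∀ x y, K.arc x y → K.arc y x)
      (h : ∀ x y, K.arc x y → ¬ K.anc x y) :
      ∀ {x y : W}, AG2Arc K x y → K.arc x y
    | _, _, .base e => e
    | _, _, .symm e => hs _ _ (e.arc_of_no_anc_arc hs h)
    | _, _, .gen _ _ e a =>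
      (h _ _ (e.arc_of_no_anc_arc hs h) (a.anc_of_no_anc_arc hs h)).elim

  theorem AG2Anc.anc_of_no_anc_arc (hs : ∀ x y, K.arc x y → K.arc y x)
      (h : ∀ x y, K.arc x y → ¬ K.anc x y) :
      ∀ {x y : W}, AG2Anc K x y → K.anc x y
    | _, _, .single e => .single (e.arrow_of_no_anc_arc hs h)
    | _, _, .tail e a => .head (e.arrow_of_no_anc_arc hs h) (a.anc_of_no_anc_arc hs h)
end

theorem ag2_eq_self (hs : ∀ x y, K.arc x y → K.arc y x)
    (h : ∀ x y, K.arc x y → ¬ K.anc x y) : ag2 K = K :=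
  MixedGraph.eq_of_iff rfl (fun _ _ => ⟨fun e => e.arrow_of_no_anc_arc hs h, .base⟩)
    (fun _ _ => ⟨fun e => e.arc_of_no_anc_arc hs h, .base⟩) fun _ _ => Iff.rfl

mutual
  theorem AG3Arrow.arrow_of_no_anc_arc (h : ∀ x y, K.arc x y → ¬ K.anc x y) :
      ∀ {x y : W}, AG3Arrow K x y → K.arrow x y
    | _, _, .base e => e
    | _, _, .conv e a => (h _ _ e (a.anc_of_no_anc_arc h)).elim

  theorem AG3Anc.anc_of_no_anc_arc (h : ∀ x y, K.arc x y → ¬ K.anc x y) :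
      ∀ {x y : W}, AG3Anc K x y → K.anc x y
    | _, _, .single e => .single (e.arrow_of_no_anc_arc h)
    | _, _, .tail e a => .head (e.arrow_of_no_anc_arc h) (a.anc_of_no_anc_arc h)
end

theorem alphaSGAG_eq_self (hs : ∀ x y, K.arc x y → K.arc y x)
    (h : ∀ x y, K.arc x y → ¬ K.anc x y) : alphaSGAG K = K := by
  refine MixedGraph.eq_of_iff rfl (fun x y => ?_) (fun x y => ?_) fun _ _ => Iff.rfl
  · simp only [alphaSGAG, ag2_eq_self hs h]
    exact ⟨fun e => e.arrow_of_no_anc_arc h, .base⟩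
  · simp only [alphaSGAG, ag2_eq_self hs h]
    exact ⟨fun e => e.1, fun e => ⟨e, fun a => h _ _ e (a.anc_of_no_anc_arc h),
      fun a => h _ _ (hs _ _ e) (a.anc_of_no_anc_arc h)⟩⟩

theorem deheadAt_eq_self {A : Set W} (hs : ∀ x y, K.arc x y → K.arc y x)
    (h : ∀ x ∈ A, ∀ y, ¬ K.arrow y x ∧ ¬ K.arc y x) : deheadAt K A = K := by
  refine MixedGraph.eq_of_iff rfl (fun x y => ?_) (fun x y => ?_) fun x y => ?_
  · exact ⟨fun e => e.2.elim id fun e => ((h x e.2 y).2 (hs _ _ e.1)).elim,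
      fun e => ⟨fun hy => (h y hy x).1 e, .inl e⟩⟩
  · exact ⟨fun e => e.1, fun e =>
      ⟨e, fun hx => (h x hx y).2 (hs _ _ e), fun hy => (h y hy x).2 e⟩⟩
  · refine ⟨?_, .inl⟩
    rintro (e | e | e | e)
    · exact e
    · exact ((h x e.2 y).1 e.1).elim
    · exact ((h y e.2 x).1 e.1).elim
    · exact ((h y e.2.2 x).2 e.1).elim

end AncestralSteps

/-- `GeneratesOnce G M S B L`: the arc and line candidates `B` and `L` contain the arcs and
lines of `G` and everything generated by a fork at a node of `M` or a collision at a node of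
`S`, while no other configuration of arrows of `G` and edges in `B` and `L` generates an edge. -/
structure GeneratesOnce {W : Type} (G : MixedGraph W) (M S : Set W) (B L : W → W → Prop) :
    Prop where
  arc_symm : ∀ x y, B x y → B y x
  line_symm : ∀ x y, L x y → L y x
  arc_le : ∀ x y, G.arc x y → B x y
  line_le : ∀ x y, G.line x y → L x y
  not_arrow : ∀ m ∈ M, ∀ x, ¬ G.arrow x m
  not_arc : ∀ m ∈ M, ∀ x, ¬ B m x
  not_line : ∀ m ∈ M, ∀ x, ¬ L x m
  not_arc_collider : ∀ s ∈ S, ∀ x, ¬ B s x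
  arc_of_fork : ∀ m ∈ M, ∀ x y, x ≠ y → G.arrow m x → G.arrow m y → B x y
  line_of_collider : ∀ s ∈ S, ∀ x y, x ≠ y → G.arrow x s → G.arrow y s → L x y

section Closure

variable {W : Type} {G : MixedGraph W} {M S : Set W} {B L : W → W → Prop}

mutual
  theorem GenArrow.of_generatesOnce (h : GeneratesOnce G M S B L) :
      ∀ {x y : W}, GenArrow G M S x y → G.arrow x y
    | _, _, .base e => e
    | _, _, .row1 hm _ e _ => (h.not_arrow _ hm _ (e.of_generatesOnce h)).elim
    | _, _, .row2 hm _ e _ => (h.not_line _ hm _ (e.of_generatesOnce h)).elim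
    | _, _, .row3 hm _ e _ => (h.not_line _ hm _ (e.of_generatesOnce h)).elim
    | _, _, .row8 hm _ _ e => (h.not_arc_collider _ hm _ (e.of_generatesOnce h)).elim

  theorem GenArc.of_generatesOnce (h : GeneratesOnce G M S B L) :
      ∀ {x y : W}, GenArc G M S x y → B x y
    | _, _, .base e => h.arc_le _ _ e
    | _, _, .symm e => h.arc_symm _ _ (e.of_generatesOnce h)
    | _, _, .row4 hm ne e e' =>
      h.arc_of_fork _ hm _ _ ne (e.of_generatesOnce h) (e'.of_generatesOnce h)
    | _, _, .row5 hm _ _ e => (h.not_arc _ hm _ (e.of_generatesOnce h)).elim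
    | _, _, .row9 hm _ _ e => (h.not_arc_collider _ hm _ (e.of_generatesOnce h)).elim

  theorem GenLine.of_generatesOnce (h : GeneratesOnce G M S B L) :
      ∀ {x y : W}, GenLine G M S x y → L x y
    | _, _, .base e => h.line_le _ _ e
    | _, _, .symm e => h.line_symm _ _ (e.of_generatesOnce h)
    | _, _, .row6 hm _ e _ => (h.not_line _ hm _ (e.of_generatesOnce h)).elim
    | _, _, .row7 hm _ e _ => (h.not_line _ hm _ (e.of_generatesOnce h)).elim
    | _, _, .row10 hm ne e e' =>
      h.line_of_collider _ hm _ _ ne (e.of_generatesOnce h) (e'.of_generatesOnce h)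
end

end Closure

/-! ### The canonical DAG of an ancestral graph -/

/-- The node subdividing the arc between `i` and `j`. -/
def sourceNode (f : V → ℕ) (i j : V) : ℕ := 2 * Nat.pair (f i) (f j)

/-- The node subdividing the line between `i` and `j`. -/
def sinkNode (f : V → ℕ) (i j : V) : ℕ := 2 * Nat.pair (f i) (f j) + 1

/-- The nodes subdividing the arcs of `H`. -/
def sources (H : MixedGraph V) (f : V → ℕ) : Set (V ⊕ ℕ) :=
  {x | ∃ i j, H.arc i j ∧ x = .inr (sourceNode f i j)}

/-- The nodes subdividing the lines of `H`. -/
def sinks (H : MixedGraph V) (f : V → ℕ) : Set (V ⊕ ℕ) :=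
  {x | ∃ i j, H.line i j ∧ x = .inr (sinkNode f i j)}

/-- The arrows of the canonical DAG: arcs `i ↔ j` become `i ← m → j` and lines `i — j`
become `i → c ← j`. -/
inductive CanonicalArrow (H : MixedGraph V) (f : V → ℕ) : V ⊕ ℕ → V ⊕ ℕ → Prop
  | arrow {i j : V} : H.arrow i j → CanonicalArrow H f (.inl i) (.inl j)
  | arc {i j k : V} : H.arc i j → k = i ∨ k = j →
      CanonicalArrow H f (.inr (sourceNode f i j)) (.inl k)
  | line {i j k : V} : H.line i j → k = i ∨ k = j →
      CanonicalArrow H f (.inl k) (.inr (sinkNode f i j))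

/-- The canonical DAG of `H`, where `f` numbers the nodes of `H`. -/
def canonicalDAG (H : MixedGraph V) (f : V → ℕ) : MixedGraph (V ⊕ ℕ) where
  nodes := Sum.inl '' H.nodes ∪ (sources H f ∪ sinks H f)
  arrow := CanonicalArrow H f
  arc _ _ := False
  line _ _ := False

section Canonical

variable {H : MixedGraph V} {f : V → ℕ}

theorem sourceNode_inj (hf : Set.InjOn f H.nodes) {i j i' j' : V} (hi : i ∈ H.nodes)
    (hj : j ∈ H.nodes) (hi' : i' ∈ H.nodes) (hj' : j' ∈ H.nodes)
    (h : sourceNode f i j = sourceNode f i' j') : i = i' ∧ j = j' := by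
  have h' : Nat.pair (f i) (f j) = Nat.pair (f i') (f j') := by
    unfold sourceNode at h
    omega
  obtain ⟨h1, h2⟩ := Nat.pair_eq_pair.1 h'
  exact ⟨hf hi hi' h1, hf hj hj' h2⟩

theorem sinkNode_inj (hf : Set.InjOn f H.nodes) {i j i' j' : V} (hi : i ∈ H.nodes)
    (hj : j ∈ H.nodes) (hi' : i' ∈ H.nodes) (hj' : j' ∈ H.nodes)
    (h : sinkNode f i j = sinkNode f i' j') : i = i' ∧ j = j' :=
  sourceNode_inj hf hi hj hi' hj' (Nat.succ_injective h)

theorem sourceNode_ne_sinkNode (i j i' j' : V) : sourceNode f i j ≠ sinkNode f i' j' := by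
  unfold sourceNode sinkNode
  omega

theorem disjoint_sources_sinks : Disjoint (sources H f) (sinks H f) := by
  rw [Set.disjoint_left]
  rintro _ ⟨i, j, -, rfl⟩ ⟨i', j', -, h⟩
  exact sourceNode_ne_sinkNode _ _ _ _ (Sum.inr.inj h)

theorem not_canonicalArrow_source {x y : V ⊕ ℕ} (hy : y ∈ sources H f) :
    ¬ CanonicalArrow H f x y := by
  obtain ⟨i, j, -, rfl⟩ := hy
  intro h
  generalize hn : sourceNode f i j = n at h
  cases h
  exact sourceNode_ne_sinkNode _ _ _ _ hn

theorem not_canonicalArrow_of_sink {x y : V ⊕ ℕ} (hx : x ∈ sinks H f) :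
    ¬ CanonicalArrow H f x y := by
  obtain ⟨i, j, -, rfl⟩ := hx
  intro h
  generalize hn : sinkNode f i j = n at h
  cases h
  exact sourceNode_ne_sinkNode _ _ _ _ hn.symm

theorem not_canonicalArrow_lineEndpoint (hH : H.IsAG) {x : V ⊕ ℕ} {i : V}
    (hi : H.LineEndpoint i) : ¬ CanonicalArrow H f x (.inl i) := by
  have key := hH.2.2.2.2 i hi
  intro h
  cases h with
  | arrow e => exact (key _).1 e
  | arc e hk =>
    rcases hk with rfl | rfl
    · exact (key _).2 (hH.1.1 _ _ e)
    · exact (key _).2 e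

theorem lineEndpoint_of_canonicalArrow_sink (hH : H.IsAG) {x y : V ⊕ ℕ} (hy : y ∈ sinks H f)
    (h : CanonicalArrow H f x y) : ∃ i, x = .inl i ∧ H.LineEndpoint i := by
  obtain ⟨i, j, -, rfl⟩ := hy
  generalize sinkNode f i j = n at h
  cases h with
  | line e hk =>
    rcases hk with rfl | rfl
    · exact ⟨_, rfl, _, e⟩
    · exact ⟨_, rfl, _, hH.1.2.1 _ _ e⟩

theorem lineEndpoint_of_mem_anSet (hH : H.IsAG) {x : V ⊕ ℕ}
    (hx : x ∈ (canonicalDAG H f).anSet (sinks H f)) :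
    ∃ i, x = .inl i ∧ H.LineEndpoint i := by
  obtain ⟨c, hc, h⟩ := hx
  induction h using Relation.TransGen.head_induction_on with
  | single e => exact lineEndpoint_of_canonicalArrow_sink hH hc e
  | head e _ ih =>
    obtain ⟨i, rfl, hi⟩ := ih
    exact (not_canonicalArrow_lineEndpoint hH hi e).elim

theorem MixedGraph.IsAG.not_anc_self (hH : H.IsAG) (i : V) : ¬ H.anc i i := by
  intro h
  cases h with
  | single e => exact (hH.2.1.1 i).1 e
  | tail a e => exact hH.2.2.2.1 _ _ (.inl e) a

theorem anc_of_canonicalDAG_anc {i : V} {x : V ⊕ ℕ}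
    (h : (canonicalDAG H f).anc (.inl i) x) :
    x ∈ sinks H f ∨ ∃ j, x = .inl j ∧ H.anc i j := by
  induction h with
  | single e =>
    cases e with
    | arrow e => exact .inr ⟨_, rfl, .single e⟩
    | line e _ => exact .inl ⟨_, _, e, rfl⟩
  | tail _ e ih =>
    rcases ih with hs | ⟨j, rfl, a⟩
    · exact (not_canonicalArrow_of_sink hs e).elim
    · cases e with
      | arrow e => exact .inr ⟨_, rfl, a.tail e⟩
      | line e _ => exact .inl ⟨_, _, e, rfl⟩

theorem canonicalDAG_not_anc_self (hH : H.IsAG) (x : V ⊕ ℕ) :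
    ¬ (canonicalDAG H f).anc x x := by
  intro h
  cases x with
  | inl i =>
    rcases anc_of_canonicalDAG_anc h with ⟨_, _, _, h'⟩ | ⟨j, hj, a⟩
    · cases h'
    · cases hj
      exact hH.not_anc_self _ a
  | inr n =>
    obtain ⟨y, e, -⟩ := Relation.TransGen.head'_iff.1 h
    obtain ⟨z, -, e'⟩ := Relation.TransGen.tail'_iff.1 h
    cases e with
    | arc e _ => exact not_canonicalArrow_source ⟨_, _, e, rfl⟩ e'

theorem canonicalDAG_isDAG (hH : H.IsAG) : (canonicalDAG H f).IsDAG := by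
  have hmem := hH.1.2.2
  refine ⟨⟨⟨fun _ _ h => h, fun _ _ h => h, ?_⟩, ?_, ?_⟩, fun _ _ h => h, fun _ _ h => h,
    canonicalDAG_not_anc_self hH⟩
  · rintro x y (h | h | h)
    · cases h with
      | arrow e =>
        exact ⟨.inl ⟨_, (hmem _ _ (.inl e)).1, rfl⟩, .inl ⟨_, (hmem _ _ (.inl e)).2, rfl⟩⟩
      | arc e hk =>
        refine ⟨.inr (.inl ⟨_, _, e, rfl⟩), .inl ⟨_, ?_, rfl⟩⟩
        rcases hk with rfl | rfl
        · exact (hmem _ _ (.inr (.inl e))).1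
        · exact (hmem _ _ (.inr (.inl e))).2
      | line e hk =>
        refine ⟨.inl ⟨_, ?_, rfl⟩, .inr (.inr ⟨_, _, e, rfl⟩)⟩
        rcases hk with rfl | rfl
        · exact (hmem _ _ (.inr (.inr e))).1
        · exact (hmem _ _ (.inr (.inr e))).2
    · exact h.elim
    · exact h.elim
  · exact fun x => ⟨fun h => canonicalDAG_not_anc_self hH x (.single h), fun h => h, fun h => h⟩
  · have hfin := hH.2.2.1
    refine (hfin.image _).union (Set.Finite.union ?_ ?_)
    · refine ((hfin.prod hfin).image fun p => Sum.inr (sourceNode f p.1 p.2)).subset ?_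
      rintro _ ⟨i, j, e, rfl⟩
      exact ⟨(i, j), hmem _ _ (.inr (.inl e)), rfl⟩
    · refine ((hfin.prod hfin).image fun p => Sum.inr (sinkNode f p.1 p.2)).subset ?_
      rintro _ ⟨i, j, e, rfl⟩
      exact ⟨(i, j), hmem _ _ (.inr (.inr e)), rfl⟩

theorem canonicalDAG_generatesOnce (hH : H.IsAG) (hf : Set.InjOn f H.nodes) :
    GeneratesOnce (canonicalDAG H f) (sources H f)
      (sinks H f ∪ (canonicalDAG H f).anSet (sinks H f))
      (H.map Sum.inl).arc (H.map Sum.inl).line where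
  arc_symm := by
    rintro _ _ ⟨i, j, e, rfl, rfl⟩
    exact ⟨j, i, hH.1.1 _ _ e, rfl, rfl⟩
  line_symm := by
    rintro _ _ ⟨i, j, e, rfl, rfl⟩
    exact ⟨j, i, hH.1.2.1 _ _ e, rfl, rfl⟩
  arc_le _ _ h := h.elim
  line_le _ _ h := h.elim
  not_arrow _ hm _ := not_canonicalArrow_source hm
  not_arc := by
    rintro _ ⟨i, j, -, rfl⟩ _ ⟨_, _, -, h, -⟩
    cases h
  not_line := by
    rintro _ ⟨i, j, -, rfl⟩ _ ⟨_, _, -, -, h⟩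
    cases h
  not_arc_collider := by
    rintro s (⟨i, j, -, rfl⟩ | hs) x ⟨i', j', e, h, -⟩
    · cases h
    · obtain ⟨i, rfl, hi⟩ := lineEndpoint_of_mem_anSet hH hs
      cases h
      exact (hH.2.2.2.2 _ hi _).2 (hH.1.1 _ _ e)
  arc_of_fork := by
    rintro _ ⟨i, j, e, rfl⟩ x y hxy hx hy
    have hmem := hH.1.2.2
    have key : ∀ x, CanonicalArrow H f (.inr (sourceNode f i j)) x →
        x = .inl i ∨ x = .inl j := by
      intro x hx
      generalize hn : sourceNode f i j = n at hx
      cases hx with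
      | arc e' hk =>
        have h1 := hmem _ _ (.inr (.inl e))
        have h2 := hmem _ _ (.inr (.inl e'))
        obtain ⟨rfl, rfl⟩ := sourceNode_inj hf h1.1 h1.2 h2.1 h2.2 hn
        exact hk.imp (congrArg _) (congrArg _)
    rcases key x hx with rfl | rfl <;> rcases key y hy with rfl | rfl
    · exact (hxy rfl).elim
    · exact ⟨_, _, e, rfl, rfl⟩
    · exact ⟨_, _, hH.1.1 _ _ e, rfl, rfl⟩
    · exact (hxy rfl).elim
  line_of_collider := by
    rintro s (⟨i, j, e, rfl⟩ | hs) x y hxy hx hy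
    · have hmem := hH.1.2.2
      have key : ∀ x, CanonicalArrow H f x (.inr (sinkNode f i j)) →
          x = .inl i ∨ x = .inl j := by
        intro x hx
        generalize hn : sinkNode f i j = n at hx
        cases hx with
        | line e' hk =>
          have h1 := hmem _ _ (.inr (.inr e))
          have h2 := hmem _ _ (.inr (.inr e'))
          obtain ⟨rfl, rfl⟩ := sinkNode_inj hf h1.1 h1.2 h2.1 h2.2 hn
          exact hk.imp (congrArg _) (congrArg _)
      rcases key x hx with rfl | rfl <;> rcases key y hy with rfl | rfl
      · exact (hxy rfl).elim
      · exact ⟨_, _, e, rfl, rfl⟩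
      · exact ⟨_, _, hH.1.2.1 _ _ e, rfl, rfl⟩
      · exact (hxy rfl).elim
    · obtain ⟨i, rfl, hi⟩ := lineEndpoint_of_mem_anSet hH hs
      exact (not_canonicalArrow_lineEndpoint hH hi hx).elim

theorem inl_mem_canonicalDAG_diff {i : V} (hi : i ∈ H.nodes) :
    Sum.inl i ∈ (canonicalDAG H f).nodes \ (sources H f ∪ sinks H f) := by
  refine ⟨.inl ⟨i, hi, rfl⟩, ?_⟩
  rintro (⟨_, _, -, h⟩ | ⟨_, _, -, h⟩) <;> cases h

theorem canonicalDAG_diff :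
    (canonicalDAG H f).nodes \ (sources H f ∪ sinks H f) = Sum.inl '' H.nodes := by
  refine Set.Subset.antisymm (fun x hx => hx.1.resolve_right hx.2) ?_
  rintro _ ⟨i, hi, rfl⟩
  exact inl_mem_canonicalDAG_diff hi

theorem alphaRG_canonicalDAG (hH : H.IsAG) (hf : Set.InjOn f H.nodes) :
    alphaRG (canonicalDAG H f) (sources H f) (sinks H f) = H.map Sum.inl := by
  have hgen := canonicalDAG_generatesOnce hH hf
  have hmem := hH.1.2.2
  refine MixedGraph.eq_of_iff canonicalDAG_diff (fun x y => ⟨?_, ?_⟩) (fun x y => ⟨?_, ?_⟩)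
    fun x y => ⟨?_, ?_⟩
  · rintro ⟨hx, hy, h⟩
    rw [canonicalDAG_diff] at hx hy
    obtain ⟨i, -, rfl⟩ := hx
    obtain ⟨j, -, rfl⟩ := hy
    cases h.of_generatesOnce hgen with
    | arrow e => exact ⟨i, j, e, rfl, rfl⟩
  · rintro ⟨i, j, e, rfl, rfl⟩
    have h := hmem _ _ (.inl e)
    exact ⟨inl_mem_canonicalDAG_diff h.1, inl_mem_canonicalDAG_diff h.2, .base (.arrow e)⟩
  · exact fun h => h.2.2.of_generatesOnce hgen
  · rintro ⟨i, j, e, rfl, rfl⟩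
    have h := hmem _ _ (.inr (.inl e))
    have hne : (Sum.inl i : V ⊕ ℕ) ≠ .inl j := by
      intro h'
      cases h'
      exact (hH.2.1.1 i).2.1 e
    exact ⟨inl_mem_canonicalDAG_diff h.1, inl_mem_canonicalDAG_diff h.2,
      .row4 ⟨i, j, e, rfl⟩ hne (.base (.arc e (.inl rfl))) (.base (.arc e (.inr rfl)))⟩
  · exact fun h => h.2.2.of_generatesOnce hgen
  · rintro ⟨i, j, e, rfl, rfl⟩
    have h := hmem _ _ (.inr (.inr e))
    have hne : (Sum.inl i : V ⊕ ℕ) ≠ .inl j := by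
      intro h'
      cases h'
      exact (hH.2.1.1 i).2.2 e
    exact ⟨inl_mem_canonicalDAG_diff h.1, inl_mem_canonicalDAG_diff h.2,
      .row10 (.inl ⟨i, j, e, rfl⟩) hne (.base (.line e (.inl rfl)))
        (.base (.line e (.inr rfl)))⟩

theorem anc_of_map_anc {W : Type} {g : V → W} (hg : Function.Injective g) {i : V} {x : W}
    (h : (H.map g).anc (g i) x) : ∃ j, g j = x ∧ H.anc i j := by
  induction h with
  | single e =>
    obtain ⟨i', j, e, hi, rfl⟩ := e
    obtain rfl := hg hi
    exact ⟨j, rfl, .single e⟩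
  | tail _ e ih =>
    obtain ⟨k, rfl, a⟩ := ih
    obtain ⟨k', j, e, hk, rfl⟩ := e
    obtain rfl := hg hk
    exact ⟨j, rfl, a.tail e⟩

theorem alphaAG_canonicalDAG (hH : H.IsAG) (hf : Set.InjOn f H.nodes) :
    alphaAG (canonicalDAG H f) (sources H f) (sinks H f) = H.map Sum.inl := by
  have hs : ∀ x y, (H.map (Sum.inl : V → V ⊕ ℕ)).arc x y → (H.map Sum.inl).arc y x :=
    (canonicalDAG_generatesOnce hH hf).arc_symm
  rw [alphaAG, alphaSG, alphaRG_canonicalDAG hH hf, deheadAt_eq_self hs, alphaSGAG_eq_self hs]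
  · rintro _ _ ⟨i, j, e, rfl, rfl⟩ a
    obtain ⟨j', h, a'⟩ := anc_of_map_anc Sum.inl_injective a
    obtain rfl := Sum.inl_injective h
    exact hH.2.2.2.1 _ _ (.inr (hH.1.1 _ _ e)) a'
  · intro x hx y
    obtain ⟨i, rfl, hi⟩ := lineEndpoint_of_mem_anSet hH hx
    constructor
    · rintro ⟨j, i', e, rfl, h⟩
      obtain rfl := Sum.inl_injective h
      exact (hH.2.2.2.2 _ hi _).1 e
    · rintro ⟨j, i', e, rfl, h⟩
      obtain rfl := Sum.inl_injective h
      exact (hH.2.2.2.2 _ hi _).2 e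

end Canonical

/-- (Proposition 8) The map `α_AG` from DAGs to ancestral
graphs is surjective: every ancestral graph `H` is of the form `α_AG(G;M,C)`
for some DAG `G` (possibly on a larger node set) and disjoint subsets `M`,
`C` of its node set. -/
theorem stmt_17 {V : Type} (H : MixedGraph V) (hH : H.IsAG) :
    ∃ (G : MixedGraph (V ⊕ ℕ)) (M C : Set (V ⊕ ℕ)),
      G.IsDAG ∧ M ⊆ G.nodes ∧ C ⊆ G.nodes ∧ Disjoint M C ∧
      alphaAG G M C = H.map Sum.inl := by
  obtain ⟨f, hf⟩ := Set.countable_iff_exists_injOn.1 hH.2.2.1.countable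
  exact ⟨canonicalDAG H f, sources H f, sinks H f, canonicalDAG_isDAG hH,
    fun _ h => .inr (.inl h), fun _ h => .inr (.inr h), disjoint_sources_sinks,
    alphaAG_canonicalDAG hH hf⟩

end StableMixedGraphs
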